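/- arXiv:2102.00973 — 6 statements merged into one kernel-verified Lean document; each statement's English description precedes it below -/
import Mathlib

section
/- Let X be a ℤ≥0-valued random variable whose failure rate function is non-decreasing. Then for all integers i ≥ 0 and s ≥ 0 such that ℙ(X ≥ s) > 0, one has ℙ(X ≥ s + i │ X ≥ s) ≤ ℙ(X ≥ i). -/
open MeasureTheory

/-- The failure rate function of a `ℕ`-valued random variable `X`:
`FailureRate(s) = ℙ(X = s | X ≥ s)` when `ℙ(X ≥ s) > 0`, and `1` otherwise. -/
noncomputable def failureRateRV {Ω : Type*} [MeasurableSpace Ω] (μ : Measure Ω)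
    (X : Ω → ℕ) (s : ℕ) : ENNReal :=
  if μ {ω | s ≤ X ω} = 0 then 1 else μ {ω | X ω = s} / μ {ω | s ≤ X ω}

/-- The survival function satisfies `ℙ(X ≥ s + 1) = ℙ(X ≥ s) (1 - FailureRate(s))`. -/
theorem measure_succ_le_eq_mul_one_sub_failureRateRV {Ω : Type*} [MeasurableSpace Ω]
    (μ : Measure Ω) [IsFiniteMeasure μ] (X : Ω → ℕ) (hX : Measurable X) (s : ℕ) :
    μ {ω | s + 1 ≤ X ω} = μ {ω | s ≤ X ω} * (1 - failureRateRV μ X s) := by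
  by_cases h : μ {ω | s ≤ X ω} = 0
  · rw [h, zero_mul]
    exact measure_mono_null (fun ω (hω : s + 1 ≤ X ω) => (Nat.le_of_succ_le hω : s ≤ X ω)) h
  · have hm : MeasurableSet {ω | X ω = s} := hX (measurableSet_singleton s)
    have hsub : {ω | X ω = s} ⊆ {ω | s ≤ X ω} := fun _ hω => Eq.ge hω
    have hset : {ω | s + 1 ≤ X ω} = {ω | s ≤ X ω} \ {ω | X ω = s} := by
      ext ω
      simp only [Set.mem_ofPred_eq, Set.mem_sdiff]
      omega
    rw [failureRateRV, if_neg h, ENNReal.mul_sub fun _ _ => measure_ne_top _ _, mul_one,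
      ENNReal.mul_div_cancel h (measure_ne_top _ _), hset,
      measure_sdiff hsub hm.nullMeasurableSet (measure_ne_top _ _)]

/-- If the failure rate is non-decreasing, then `ℙ(X ≥ s + i) ≤ ℙ(X ≥ i) ℙ(X ≥ s)`. -/
theorem measure_add_le_le_mul_of_monotone_failureRateRV {Ω : Type*} [MeasurableSpace Ω]
    (μ : Measure Ω) [IsProbabilityMeasure μ] (X : Ω → ℕ) (hX : Measurable X)
    (hmono : Monotone (failureRateRV μ X)) (i s : ℕ) :
    μ {ω | s + i ≤ X ω} ≤ μ {ω | i ≤ X ω} * μ {ω | s ≤ X ω} := by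
  induction i with
  | zero => simp
  | succ i ih =>
    calc μ {ω | s + i + 1 ≤ X ω}
        = μ {ω | s + i ≤ X ω} * (1 - failureRateRV μ X (s + i)) :=
          measure_succ_le_eq_mul_one_sub_failureRateRV μ X hX (s + i)
      _ ≤ μ {ω | i ≤ X ω} * μ {ω | s ≤ X ω} * (1 - failureRateRV μ X i) :=
          mul_le_mul' ih (tsub_le_tsub_left (hmono (Nat.le_add_left i s)) 1)
      _ = μ {ω | i + 1 ≤ X ω} * μ {ω | s ≤ X ω} := by
          rw [measure_succ_le_eq_mul_one_sub_failureRateRV μ X hX i, mul_right_comm]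

/-- If the `ℕ`-valued random variable `X` has a non-decreasing failure rate
function, then for all `i, s ≥ 0` with `ℙ(X ≥ s) > 0` one has
`ℙ(X ≥ s + i | X ≥ s) ≤ ℙ(X ≥ i)`. -/
theorem stmt_3 {Ω : Type*} [MeasurableSpace Ω] (μ : Measure Ω) [IsProbabilityMeasure μ]
    (X : Ω → ℕ) (hX : Measurable X) (hmono : Monotone (failureRateRV μ X)) :
    ∀ i s : ℕ, 0 < μ {ω | s ≤ X ω} →
      μ {ω | s + i ≤ X ω} / μ {ω | s ≤ X ω} ≤ μ {ω | i ≤ X ω} := by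
  intro i s _
  exact ENNReal.div_le_of_le_mul
    (measure_add_le_le_mul_of_monotone_failureRateRV μ X hX hmono i s)
end

section
/- Let 0 < ε ≤ 1 and 0 ≤ c < ε, and let Y be a random variable taking the value 1 + c with probability (1−ε)/2 and the value −1 + c with probability (1+ε)/2. Then E[exp(2(ε−c)·Y)] ≤ 1. -/
open MeasureTheory

/-- The expectation of a random variable taking only the values `a` and `b`. -/
lemma integral_of_forall_eq_or_eq {Ω : Type*} [MeasurableSpace Ω] (μ : Measure Ω)
    [IsProbabilityMeasure μ] {Y : Ω → ℝ} (hmeas : Measurable Y) {a b : ℝ}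
    (hval : ∀ ω, Y ω = a ∨ Y ω = b) :
    ∫ ω, Y ω ∂μ = b + μ.real {ω | Y ω = a} * (a - b) := by
  have hS : MeasurableSet {ω | Y ω = a} := hmeas (measurableSet_singleton a)
  have hY : Y = fun ω => b + {ω | Y ω = a}.indicator (fun _ => a - b) ω := by
    funext ω
    by_cases h : Y ω = a
    · simp [h]
    · rw [Set.indicator_of_notMem (s := {ω | Y ω = a}) h, add_zero, (hval ω).resolve_left h]
  calc ∫ ω, Y ω ∂μ = ∫ ω, (b + {ω | Y ω = a}.indicator (fun _ => a - b) ω) ∂μ :=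
        congrArg (fun f : Ω → ℝ => ∫ ω, f ω ∂μ) hY
    _ = b + μ.real {ω | Y ω = a} * (a - b) := by
        rw [integral_add (integrable_const b) ((integrable_const (a - b)).indicator hS),
          integral_indicator_const _ hS]
        simp

/-- Let `0 < ε ≤ 1`, `0 ≤ c < ε`, and let `Y` take the value `1 + c` with
probability `(1-ε)/2` and `-1 + c` with probability `(1+ε)/2`.  Then
`E[exp(2 (ε - c) Y)] ≤ 1`. -/
theorem stmt_7 {Ω : Type*} [MeasurableSpace Ω] (μ : Measure Ω) [IsProbabilityMeasure μ]
    (ε : ℝ) (hε0 : 0 < ε) (hε1 : ε ≤ 1) (c : ℝ) (hc0 : 0 ≤ c) (hcε : c < ε)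
    (Y : Ω → ℝ) (hmeas : Measurable Y)
    (hval : ∀ ω, Y ω = 1 + c ∨ Y ω = -1 + c)
    (hdist : μ {ω | Y ω = 1 + c} = ENNReal.ofReal ((1 - ε) / 2)) :
    ∫ ω, Real.exp (2 * (ε - c) * Y ω) ∂μ ≤ 1 := by
  have hmean : ∫ ω, Y ω ∂μ = c - ε := by
    rw [integral_of_forall_eq_or_eq μ hmeas hval, measureReal_def, hdist,
      ENNReal.toReal_ofReal (by linarith)]
    ring
  have hmem : ∀ᵐ ω ∂μ, Y ω ∈ Set.Icc (-1 + c) (1 + c) :=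
    Filter.Eventually.of_forall fun ω => by
      rcases hval ω with h | h <;> rw [h] <;> constructor <;> linarith
  have hsub := ProbabilityTheory.hasSubgaussianMGF_of_mem_Icc hmeas.aemeasurable hmem
  have hle := hsub.mgf_le (2 * (ε - c))
  have hnorm : ‖1 + c - (-1 + c)‖₊ = 2 := by
    rw [show 1 + c - (-1 + c) = (2 : ℝ) by ring]
    simp
  rw [hmean, hnorm, div_self two_ne_zero, one_pow, NNReal.coe_one, one_mul] at hle
  calc ∫ ω, Real.exp (2 * (ε - c) * Y ω) ∂μ
      = Real.exp (2 * (ε - c) * (c - ε)) *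
          ∫ ω, Real.exp (2 * (ε - c) * (Y ω - (c - ε))) ∂μ := by
        rw [← integral_const_mul]
        simp_rw [← Real.exp_add]
        congr with ω
        ring_nf
    _ ≤ Real.exp (2 * (ε - c) * (c - ε)) * Real.exp ((2 * (ε - c)) ^ 2 / 2) :=
        mul_le_mul_of_nonneg_left hle (Real.exp_nonneg _)
    _ = 1 := by
        rw [← Real.exp_add, Real.exp_eq_one_iff]
        ring
end

section
/- Let f ∈ (0,1), α ∈ (0,1], and let (F_b)_{b ≥ 0} be a non-decreasing sequence in [0,1] (the CDF values F_b = ℙ(Δ ≤ b) of a ℤ≥0-valued random variable Δ). Set p = α · Σ_{b=0}^{∞} f(1−f)^b F_b and assume p > 1/2, and write ρ = (1−p)/p. Consider the Markov transition probabilities on the state space ℤ≥0 × ℤ≥0 defined, for each state (b, r), by: (b, r) → (b+1, r) with probability 1−f; (b, r) → (0, max(r−1, 0)) with probability f·α·F_b; and (b, r) → (0, r+1) with probability f·(1 − α·F_b). Then the probability mass function π(b, r) = f(1−f)^b · (1 − ρ) · ρ^r on ℤ≥0 × ℤ≥0 is a stationary (invariant) distribution for these transition probabilities: for every state (b, r),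 Σ_{(b', r')} π(b', r') · P((b', r') → (b, r)) = π(b, r). -/
/-- The Markov transition probabilities on `ℕ × ℕ`:
from state `(b, r)`, go to `(b+1, r)` with probability `1 - f`, to
`(0, max (r-1) 0)` with probability `f α F_b`, and to `(0, r+1)` with probability
`f (1 - α F_b)`.  (Here `r - 1` is truncated subtraction on `ℕ`.) -/
noncomputable def transP (f α : ℝ) (F : ℕ → ℝ) (x y : ℕ × ℕ) : ℝ :=
  (if y = (x.1 + 1, x.2) then 1 - f else 0)
    + (if y = (0, x.2 - 1) then f * α * F x.1 else 0)
    + (if y = (0, x.2 + 1) then f * (1 - α * F x.1) else 0)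

/-- A function on a product supported on a single row sums to the sum of that row. -/
theorem hasSum_prod_row {β γ : Type*} [DecidableEq γ] {a : β → ℝ} {s : ℝ} (ha : HasSum a s)
    (k : γ) : HasSum (fun x : β × γ => if x.2 = k then a x.1 else 0) s := by
  have hinj : Function.Injective (fun b : β => (b, k)) := fun _ _ h => congrArg Prod.fst h
  refine (hinj.hasSum_iff ?_).1 (by simpa [Function.comp_def] using ha)
  rintro ⟨b, r⟩ hx
  have hr : r ≠ k := by
    rintro rfl
    exact hx ⟨b, rfl⟩
  simp [hr]

/-- With `p = α ∑_b f (1-f)^b F_b > 1/2` and `ρ = (1-p)/p`, the probability mass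
function `π(b, r) = f (1-f)^b (1-ρ) ρ^r` on `ℕ × ℕ` is stationary for the above
transition probabilities: `∑_x π(x) P(x → y) = π(y)` for every state `y`. -/
theorem stmt_10 (f α : ℝ) (hf : f ∈ Set.Ioo (0 : ℝ) 1) (hα : α ∈ Set.Ioc (0 : ℝ) 1)
    (F : ℕ → ℝ) (hFmono : Monotone F) (hF : ∀ b, F b ∈ Set.Icc (0 : ℝ) 1)
    (p : ℝ) (hp : p = α * ∑' b : ℕ, f * (1 - f) ^ b * F b) (hp2 : 1 / 2 < p)
    (ρ : ℝ) (hρ : ρ = (1 - p) / p) :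
    ∀ y : ℕ × ℕ,
      (∑' x : ℕ × ℕ, (f * (1 - f) ^ x.1 * (1 - ρ) * ρ ^ x.2) * transP f α F x y)
        = f * (1 - f) ^ y.1 * (1 - ρ) * ρ ^ y.2 := by
  have hp0 : p ≠ 0 := by linarith
  have hpρ : p * ρ = 1 - p := by rw [hρ]; field_simp
  have hf0 : 0 ≤ 1 - f := by linarith [hf.2]
  have hgeo : HasSum (fun b : ℕ => f * (1 - f) ^ b) 1 := by
    have h := (hasSum_geometric_of_lt_one hf0 (by linarith [hf.1])).mul_left f
    rwa [sub_sub_cancel, mul_inv_cancel₀ hf.1.ne'] at h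
  have hgeoF : HasSum (fun b : ℕ => α * (f * (1 - f) ^ b * F b)) p := by
    have hs : Summable (fun b : ℕ => f * (1 - f) ^ b * F b) :=
      Summable.of_nonneg_of_le
        (fun b => mul_nonneg (mul_nonneg hf.1.le (pow_nonneg hf0 b)) (hF b).1)
        (fun b => mul_le_of_le_one_right (mul_nonneg hf.1.le (pow_nonneg hf0 b)) (hF b).2)
        hgeo.summable
    rw [hp]
    exact hs.hasSum.mul_left α
  have hdown (k : ℕ) :=
    hasSum_prod_row (hgeoF.mul_left (f * (1 - ρ) * ρ ^ k)) k
  have hup (k : ℕ) :=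
    hasSum_prod_row ((hgeo.sub hgeoF).mul_left (f * (1 - ρ) * ρ ^ k)) k
  rintro ⟨_ | c, s⟩
  · rcases s with _ | s
    · convert ((hdown 0).add (hdown 1)).tsum_eq using 1
      · refine tsum_congr ?_
        rintro ⟨b, _ | _ | r⟩ <;> simp [transP] <;> ring
      · linear_combination (-f * (1 - ρ)) * hpρ
    · convert ((hdown (s + 2)).add (hup s)).tsum_eq using 1
      · refine tsum_congr ?_
        rintro ⟨b, r⟩
        have h₁ : s + 1 = r - 1 ↔ r = s + 2 := by omega
        simp only [transP, Prod.mk.injEq, h₁, add_left_inj, eq_comm (a := s) (b := r)]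
        by_cases h₂ : r = s
        · subst h₂
          simp
          ring
        · by_cases h₃ : r = s + 2
          · subst h₃
            simp
            ring
          · simp [h₂, h₃]
      · linear_combination (f * (1 - ρ) * ρ ^ s * (1 - ρ)) * hpρ
  · rw [tsum_eq_single (c, s)]
    · simp [transP]
      ring
    · rintro ⟨b, r⟩ hx
      have h : ¬(c = b ∧ s = r) := fun h => hx (by rw [h.1, h.2])
      simp [transP, h]
end

section
/- For every real ε with 0 < ε < 1, one has 1 + ε³/3 < sqrt( (1/(1+ε)) · ( 2/sqrt(1−ε²) − 1/(1+ε) ) ). -/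
/-- The polynomial inequality behind `stmt_11`, after clearing both square roots. -/
theorem sq_mul_one_sub_lt {x : ℝ} (hx : 0 < x) :
    ((1 + x ^ 3 / 3) ^ 2 * (1 + x) ^ 2 + 1) ^ 2 * (1 - x) < 4 * (1 + x) := by
  have hcubic : 0 < 4 / 3 - 7 / 3 * x - 1 / 3 * x ^ 2 + 28 / 9 * x ^ 3 := by
    nlinarith [mul_nonneg hx.le (sq_nonneg (x - 1 / 2)), sq_nonneg (x - 14 / 25)]
  have htail : 0 < 16 / 9 * x ^ 4 + 2 / 9 * x ^ 5 + 38 / 27 * x ^ 6 + 14 / 9 * x ^ 7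
      + 10 / 27 * x ^ 8 + 23 / 81 * x ^ 9 + 11 / 27 * x ^ 10 + 10 / 81 * x ^ 11
      + 2 / 81 * x ^ 12 + 1 / 27 * x ^ 13 + 1 / 81 * x ^ 14 := by
    positivity
  have h := mul_pos (pow_pos hx 3) (add_pos hcubic htail)
  linear_combination h

/-- For every real `ε` with `0 < ε < 1`,
`1 + ε³/3 < sqrt( (1/(1+ε)) ( 2/sqrt(1-ε²) - 1/(1+ε) ) )`. -/
theorem stmt_11 (ε : ℝ) (hε : ε ∈ Set.Ioo (0 : ℝ) 1) :
    1 + ε ^ 3 / 3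
      < Real.sqrt ((1 / (1 + ε)) * (2 / Real.sqrt (1 - ε ^ 2) - 1 / (1 + ε))) := by
  obtain ⟨h0, h1⟩ := hε
  have hpos : 0 < 1 + ε := by linarith
  have hs : 0 < 1 - ε ^ 2 := by nlinarith
  have hroot : 0 < Real.sqrt (1 - ε ^ 2) := Real.sqrt_pos.2 hs
  apply Real.lt_sqrt_of_sq_lt
  have key : ((1 + ε ^ 3 / 3) ^ 2 * (1 + ε) ^ 2 + 1) * Real.sqrt (1 - ε ^ 2)
      < 2 * (1 + ε) := by
    refine lt_of_pow_lt_pow_left₀ 2 (by positivity) ?_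
    rw [mul_pow, Real.sq_sqrt hs.le]
    linear_combination (1 + ε) * sq_mul_one_sub_lt h0
  have hdiv : (1 + ε ^ 3 / 3) ^ 2 * (1 + ε) ^ 2 + 1
      < 2 * (1 + ε) / Real.sqrt (1 - ε ^ 2) := (lt_div_iff₀ hroot).2 key
  have hrw : (1 / (1 + ε)) * (2 / Real.sqrt (1 - ε ^ 2) - 1 / (1 + ε))
      = (2 * (1 + ε) / Real.sqrt (1 - ε ^ 2) - 1) / (1 + ε) ^ 2 := by
    field_simp
  rw [hrw, lt_div_iff₀ (by positivity)]
  linarith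
end

section
/- Let i ∈ ℕ, let w ∈ {⊥,0,1}^i, let s ∈ ℕ with s ≤ i, and let l ∈ ℤ≥0 with l ≤ i; set w' = O_l(w). There exists an (s, l)-balanced fork F ⊢ w if and only if there exists an s-balanced fork F' ⊢ w'. -/
/-- The alphabet `{⊥, 0, 1}`: `none` is `⊥` (empty slot), `some false` is `0`
(special honest slot), `some true` is `1` (adversarial slot). -/
abbrev Trit : Type := Option Bool

/-- Depth of a vertex in a rooted tree given by a parent function, computed with
fuel (fuel `v` suffices since parents have smaller indices). -/
def depthAux (parent : ℕ → ℕ) : ℕ → ℕ → ℕ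
  | 0, _ => 0
  | fuel + 1, v => if v = 0 then 0 else depthAux parent fuel (parent v) + 1

/-- Depth of vertex `v` (number of edges from the root `0`). -/
def treeDepth (parent : ℕ → ℕ) (v : ℕ) : ℕ := depthAux parent v v

/-- A fork `F ⊢ w` with respect to a characteristic string `w ∈ {⊥,0,1}^i`
(positions `1, …, i`).  The vertices are `0, 1, …, m - 1`; vertex `0` is the root,
every other vertex has a parent of smaller index (edges directed away from the
root).  `label` is the labeling `ℓ`: the root has label `0`, every other vertex is
labeled by an index `j ∈ {1, …, i}` with `w[j] ≠ ⊥`; labels strictly increase along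
directed paths; every index `j` with `w[j] = 0` is the label of exactly one vertex;
and the depths of the vertices with such labels increase strictly with the label. -/
structure Fork (i : ℕ) (w : ℕ → Trit) : Type where
  m : ℕ
  m_pos : 0 < m
  parent : ℕ → ℕ
  label : ℕ → ℕ
  parent_root : parent 0 = 0
  parent_lt : ∀ v, 0 < v → v < m → parent v < v
  label_root : label 0 = 0
  label_valid : ∀ v, 0 < v → v < m → 1 ≤ label v ∧ label v ≤ i ∧ w (label v) ≠ none
  label_lt : ∀ v, 0 < v → v < m → label (parent v) < label v
  honest_unique : ∀ j, 1 ≤ j → j ≤ i → w j = some false →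
    ∃! v, 0 < v ∧ v < m ∧ label v = j
  honest_depth_mono : ∀ v₁ v₂, 0 < v₁ → v₁ < m → 0 < v₂ → v₂ < m →
    w (label v₁) = some false → w (label v₂) = some false →
    label v₁ < label v₂ → treeDepth parent v₁ < treeDepth parent v₂

namespace Fork

variable {i : ℕ} {w : ℕ → Trit}

/-- Depth of a vertex of the fork. A tine is a directed path from the root, so
tines are identified with their terminal vertices; the length of the tine ending at
`v` is `F.depth v`. -/
def depth (F : Fork i w) (v : ℕ) : ℕ := treeDepth F.parent v

/-- `u` is an ancestor of `v` (or `u = v`), i.e. `u` lies on the tine ending at `v`. -/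
def Ancestor (F : Fork i w) (u v : ℕ) : Prop := ∃ k : ℕ, F.parent^[k] v = u

/-- The tines ending at `v₁` and `v₂` are `s`-disjoint (`t₁ ≁ₛ t₂`): they share no
vertex whose label is `≥ s`. -/
def SDisjoint (F : Fork i w) (s v₁ v₂ : ℕ) : Prop :=
  ∀ u, F.Ancestor u v₁ → F.Ancestor u v₂ → F.label u < s

/-- `v` is a leaf of the fork. -/
def IsLeaf (F : Fork i w) (v : ℕ) : Prop := ∀ u, 0 < u → u < F.m → F.parent u ≠ v

/-- The fork is closed: every leaf has a label `j` with `w[j] = 0`. -/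
def Closed (F : Fork i w) : Prop :=
  ∀ v, 0 < v → v < F.m → F.IsLeaf v → w (F.label v) = some false

/-- The length of the longest tine of the fork. -/
noncomputable def maxDepth (F : Fork i w) : ℕ :=
  sSup {d : ℕ | ∃ v, v < F.m ∧ d = F.depth v}

/-- `reserve(t)` for the tine `t` ending at `v`: the number of indices `j > ℓ(t)`
with `w[j] = 1`. -/
def reserve (F : Fork i w) (v : ℕ) : ℕ :=
  ((Finset.Icc 1 i).filter fun j => F.label v < j ∧ w j = some true).card

/-- `reach(t) = reserve(t) - gap(t)` for the tine `t` ending at `v`, where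
`gap(t)` is the length of the longest tine minus `length(t)`. -/
noncomputable def reach (F : Fork i w) (v : ℕ) : ℤ :=
  (F.reserve v : ℤ) - ((F.maxDepth : ℤ) - (F.depth v : ℤ))

/-- `Reach(F, w)`: the largest reach attained by any tine of `F`. -/
noncomputable def reachFork (F : Fork i w) : ℤ :=
  sSup {z : ℤ | ∃ v, v < F.m ∧ z = F.reach v}

/-- `Margin_s(F, w)`: the maximum over pairs of `s`-disjoint tines `t₁ ≁ₛ t₂` of
`min{reach(t₁), reach(t₂)}`. -/
noncomputable def marginFork (F : Fork i w) (s : ℕ) : ℤ :=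
  sSup {z : ℤ | ∃ v₁ v₂, v₁ < F.m ∧ v₂ < F.m ∧ F.SDisjoint s v₁ v₂ ∧
    z = min (F.reach v₁) (F.reach v₂)}

/-- The tine ending at `v` is `l`-viable: for every index `j ≤ l` with `w[j] = 0`,
the depth of the (unique) vertex labeled `j` is at most the length of the tine.
A tine is viable iff it is `i`-viable. -/
def Viable (F : Fork i w) (l v : ℕ) : Prop :=
  ∀ j, 1 ≤ j → j ≤ l → w j = some false →
    ∀ u, 0 < u → u < F.m → F.label u = j → F.depth u ≤ F.depth v

/-- The fork is `(s, l)`-balanced: it contains two `l`-viable tines that are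
`s`-disjoint.  It is `s`-balanced iff it is `(s, i)`-balanced. -/
def Balanced (F : Fork i w) (s l : ℕ) : Prop :=
  ∃ v₁ v₂, v₁ < F.m ∧ v₂ < F.m ∧ F.Viable l v₁ ∧ F.Viable l v₂ ∧ F.SDisjoint s v₁ v₂

/-- The length of the longest tine of the closure `F̄` of `F` (the closure is
obtained by trimming all trailing adversarial vertices, so the length of its
longest tine is the maximum depth of an honest vertex or of the root). -/
noncomputable def closureMaxDepth (F : Fork i w) : ℕ :=
  sSup {d : ℕ | ∃ v, v < F.m ∧ (v = 0 ∨ w (F.label v) = some false) ∧ d = F.depth v}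

end Fork

/-- `Reach(w)`: the maximum of `Reach(F, w)` over all closed forks `F ⊢ w`. -/
noncomputable def ReachStr (i : ℕ) (w : ℕ → Trit) : ℤ :=
  sSup {z : ℤ | ∃ F : Fork i w, F.Closed ∧ z = F.reachFork}

/-- `Margin_s(w)`: the maximum of `Margin_s(F, w)` over all closed forks `F ⊢ w`. -/
noncomputable def MarginStr (i : ℕ) (w : ℕ → Trit) (s : ℕ) : ℤ :=
  sSup {z : ℤ | ∃ F : Fork i w, F.Closed ∧ z = F.marginFork s}

/-- `O_l(w)`: the string obtained from `w` by replacing every symbol `0` at a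
position `> l` by `⊥`. -/
def Ol (l : ℕ) (w : ℕ → Trit) : ℕ → Trit :=
  fun j => if l < j ∧ w j = some false then none else w j

lemma depthAux_eq_treeDepth {parent : ℕ → ℕ} {m : ℕ}
    (h : ∀ v, 0 < v → v < m → parent v < v) :
    ∀ fuel v, v < m → v ≤ fuel → depthAux parent fuel v = treeDepth parent v := by
  suffices H : ∀ v, v < m → ∀ f g, v ≤ f → v ≤ g →
      depthAux parent f v = depthAux parent g v from
    fun fuel v hv hf => H v hv fuel v hf le_rfl
  intro v
  induction v using Nat.strong_induction_on with
  | _ v ih =>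
    intro hv f g hf hg
    rcases Nat.eq_zero_or_pos v with rfl | hpos
    · cases f <;> cases g <;> simp [depthAux]
    · obtain ⟨f, rfl⟩ : ∃ k, f = k + 1 := ⟨f - 1, by omega⟩
      obtain ⟨g, rfl⟩ : ∃ k, g = k + 1 := ⟨g - 1, by omega⟩
      have hp := h v hpos hv
      simp only [depthAux, hpos.ne', if_false]
      rw [ih _ hp (hp.trans hv) f g (by omega) (by omega)]

lemma treeDepth_eq_succ {parent : ℕ → ℕ} {m : ℕ}
    (h : ∀ v, 0 < v → v < m → parent v < v) {v : ℕ} (hpos : 0 < v) (hv : v < m) :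
    treeDepth parent v = treeDepth parent (parent v) + 1 := by
  have hp := h v hpos hv
  obtain ⟨k, rfl⟩ : ∃ k, v = k + 1 := ⟨v - 1, by omega⟩
  rw [← depthAux_eq_treeDepth h k (parent (k + 1)) (hp.trans hv) (by omega)]
  simp [treeDepth, depthAux]

/-- A map of rooted trees that commutes with taking parents preserves depths. -/
lemma treeDepth_map {parent parent' : ℕ → ℕ} {m m' : ℕ} {φ : ℕ → ℕ}
    (h : ∀ v, 0 < v → v < m → parent v < v) (h' : ∀ v, 0 < v → v < m' → parent' v < v)
    (hφ₀ : φ 0 = 0) (hφ_pos : ∀ v, 0 < v → v < m' → 0 < φ v)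
    (hφ_lt : ∀ v, v < m' → φ v < m)
    (hφ : ∀ v, 0 < v → v < m' → φ (parent' v) = parent (φ v)) {v : ℕ} (hv : v < m') :
    treeDepth parent (φ v) = treeDepth parent' v := by
  induction v using Nat.strong_induction_on with
  | _ v ih =>
    rcases Nat.eq_zero_or_pos v with rfl | hpos
    · simp [hφ₀, treeDepth, depthAux]
    · have hp := h' v hpos hv
      rw [treeDepth_eq_succ h (hφ_pos v hpos hv) (hφ_lt v hv), treeDepth_eq_succ h' hpos hv,
        ← hφ v hpos hv, ih _ hp (hp.trans hv)]

namespace Fork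

variable {i : ℕ} {w w' : ℕ → Trit}

lemma parent_lt_m (F : Fork i w) {v : ℕ} (hv : v < F.m) : F.parent v < F.m := by
  rcases Nat.eq_zero_or_pos v with rfl | hpos
  · rwa [F.parent_root]
  · exact (F.parent_lt v hpos hv).trans hv

lemma iterate_parent_lt_m (F : Fork i w) {v : ℕ} (hv : v < F.m) (k : ℕ) :
    F.parent^[k] v < F.m := by
  induction k with
  | zero => exact hv
  | succ k ih => rw [Function.iterate_succ_apply']; exact F.parent_lt_m ih

lemma label_parent_le (F : Fork i w) {v : ℕ} (hv : v < F.m) :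
    F.label (F.parent v) ≤ F.label v := by
  rcases Nat.eq_zero_or_pos v with rfl | hpos
  · rw [F.parent_root]
  · exact (F.label_lt v hpos hv).le

lemma label_le_of_ancestor (F : Fork i w) {u v : ℕ} (hv : v < F.m) (h : F.Ancestor u v) :
    F.label u ≤ F.label v := by
  obtain ⟨k, rfl⟩ := h
  induction k with
  | zero => rfl
  | succ k ih =>
    rw [Function.iterate_succ_apply']
    exact (F.label_parent_le (F.iterate_parent_lt_m hv k)).trans ih

lemma Ancestor.refl (F : Fork i w) (v : ℕ) : F.Ancestor v v := ⟨0, rfl⟩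

lemma Ancestor.of_parent {F : Fork i w} {u v : ℕ} (h : F.Ancestor u (F.parent v)) :
    F.Ancestor u v := by
  obtain ⟨k, rfl⟩ := h
  exact ⟨k + 1, rfl⟩

lemma Ancestor.eq_or_parent {F : Fork i w} {u v : ℕ} (h : F.Ancestor u v) :
    u = v ∨ F.Ancestor u (F.parent v) := by
  obtain ⟨_ | k, rfl⟩ := h
  · exact .inl rfl
  · exact .inr ⟨k, rfl⟩

lemma Ancestor.trans {F : Fork i w} {u v x : ℕ} (h₁ : F.Ancestor u v) (h₂ : F.Ancestor v x) :
    F.Ancestor u x := by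
  obtain ⟨a, rfl⟩ := h₁
  obtain ⟨b, rfl⟩ := h₂
  exact ⟨a + b, Function.iterate_add_apply _ _ _ _⟩

lemma SDisjoint.mono {F : Fork i w} {s v₁ v₂ u₁ u₂ : ℕ} (h : F.SDisjoint s v₁ v₂)
    (h₁ : F.Ancestor u₁ v₁) (h₂ : F.Ancestor u₂ v₂) : F.SDisjoint s u₁ u₂ :=
  fun u hu₁ hu₂ => h u (hu₁.trans h₁) (hu₂.trans h₂)

lemma iterate_parent_map {F : Fork i w} {F' : Fork i w'} {φ : ℕ → ℕ}
    (hφ : ∀ v, v < F'.m → φ (F'.parent v) = F.parent (φ v)) {v : ℕ} (hv : v < F'.m) (k : ℕ) :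
    φ (F'.parent^[k] v) = F.parent^[k] (φ v) := by
  induction k with
  | zero => rfl
  | succ k ih =>
    rw [Function.iterate_succ_apply', Function.iterate_succ_apply',
      hφ _ (F'.iterate_parent_lt_m hv k), ih]

/-- Forks only depend on the positions `1, …, i` of the characteristic string. -/
def congr (F : Fork i w) (h : ∀ j, 1 ≤ j → j ≤ i → w j = w' j) : Fork i w' where
  m := F.m
  m_pos := F.m_pos
  parent := F.parent
  label := F.label
  parent_root := F.parent_root
  parent_lt := F.parent_lt
  label_root := F.label_root
  label_valid v hpos hv := by
    have H := F.label_valid v hpos hv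
    exact ⟨H.1, H.2.1, h _ H.1 H.2.1 ▸ H.2.2⟩
  label_lt := F.label_lt
  honest_unique j h₁ h₂ hj := F.honest_unique j h₁ h₂ (by rw [h j h₁ h₂, hj])
  honest_depth_mono v₁ v₂ hp₁ hv₁ hp₂ hv₂ h₁ h₂ hlt := by
    have H₁ := F.label_valid v₁ hp₁ hv₁
    have H₂ := F.label_valid v₂ hp₂ hv₂
    refine F.honest_depth_mono v₁ v₂ hp₁ hv₁ hp₂ hv₂ ?_ ?_ hlt
    · rw [h _ H₁.1 H₁.2.1, h₁]
    · rw [h _ H₂.1 H₂.2.1, h₂]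

lemma Balanced.congr {F : Fork i w} {s l : ℕ} (hF : F.Balanced s l) (hl : l ≤ i)
    (h : ∀ j, 1 ≤ j → j ≤ i → w j = w' j) : (F.congr h).Balanced s l := by
  obtain ⟨v₁, v₂, h₁, h₂, hv₁, hv₂, hd⟩ := hF
  exact ⟨v₁, v₂, h₁, h₂,
    fun j hj₁ hjl hj => hv₁ j hj₁ hjl (by rw [h j hj₁ (hjl.trans hl), hj]),
    fun j hj₁ hjl hj => hv₂ j hj₁ hjl (by rw [h j hj₁ (hjl.trans hl), hj]), hd⟩

lemma update_parent_lt (F : Fork i w) {p : ℕ} (hp : p < F.m) (v : ℕ) (hpos : 0 < v)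
    (hv : v < F.m + 1) : Function.update F.parent F.m p v < v := by
  rcases Nat.lt_succ_iff_lt_or_eq.1 hv with hv | rfl
  · rw [Function.update_of_ne hv.ne]
    exact F.parent_lt v hpos hv
  · simpa using hp

lemma treeDepth_update_parent (F : Fork i w) {p : ℕ} (hp : p < F.m) {v : ℕ} (hv : v < F.m) :
    treeDepth (Function.update F.parent F.m p) v = treeDepth F.parent v :=
  treeDepth_map (φ := id) (m := F.m + 1) (m' := F.m) (F.update_parent_lt hp) F.parent_lt rfl
    (fun _ h _ => h) (fun _ h => Nat.lt_succ_of_lt h)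
    (fun v _ hv => by simp [Function.update_of_ne hv.ne]) hv

/-- Turn a position `a` with `w[a] = ⊥` into a `0`, by adding a child of `p` labeled `a`
to a fork, where `p` is at least as deep as all honest vertices. -/
def addHonest (F : Fork i w) (a p : ℕ) (ha₁ : 1 ≤ a) (hai : a ≤ i) (hwa : w a = none)
    (hlast : ∀ j, j ≤ i → w j = some false → j < a)
    (hp : p < F.m) (hpa : F.label p < a)
    (hmax : ∀ v, 0 < v → v < F.m → w (F.label v) = some false → F.depth v ≤ F.depth p) :
    Fork i (Function.update w a (some false)) where
  m := F.m + 1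
  m_pos := Nat.succ_pos _
  parent := Function.update F.parent F.m p
  label := Function.update F.label F.m a
  parent_root := by rw [Function.update_of_ne F.m_pos.ne, F.parent_root]
  parent_lt := F.update_parent_lt hp
  label_root := by rw [Function.update_of_ne F.m_pos.ne, F.label_root]
  label_valid v hpos hv := by
    rcases Nat.lt_succ_iff_lt_or_eq.1 hv with hv | rfl
    · rw [Function.update_of_ne hv.ne]
      have H := F.label_valid v hpos hv
      refine ⟨H.1, H.2.1, ?_⟩
      have hne : F.label v ≠ a := fun h => H.2.2 (h ▸ hwa)
      rw [Function.update_of_ne hne]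
      exact H.2.2
    · simp [ha₁, hai]
  label_lt v hpos hv := by
    rcases Nat.lt_succ_iff_lt_or_eq.1 hv with hv | rfl
    · rw [Function.update_of_ne hv.ne, Function.update_of_ne hv.ne,
        Function.update_of_ne (F.parent_lt_m hv).ne]
      exact F.label_lt v hpos hv
    · simpa [Function.update_of_ne hp.ne] using hpa
  honest_unique j h₁ h₂ hj := by
    by_cases hja : j = a
    · subst hja
      refine ⟨F.m, ⟨F.m_pos, Nat.lt_succ_self _, by simp⟩, ?_⟩
      rintro v ⟨hpos, hv, hlab⟩
      rcases Nat.lt_succ_iff_lt_or_eq.1 hv with hv | rfl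
      · rw [Function.update_of_ne hv.ne] at hlab
        exact absurd (hlab ▸ hwa) (F.label_valid v hpos hv).2.2
      · rfl
    · rw [Function.update_of_ne hja] at hj
      obtain ⟨v, ⟨hpos, hv, hlab⟩, huniq⟩ := F.honest_unique j h₁ h₂ hj
      refine ⟨v, ⟨hpos, Nat.lt_succ_of_lt hv, by rw [Function.update_of_ne hv.ne, hlab]⟩, ?_⟩
      rintro u ⟨hu, hum, hul⟩
      rcases Nat.lt_succ_iff_lt_or_eq.1 hum with hum | rfl
      · rw [Function.update_of_ne hum.ne] at hul
        exact huniq u ⟨hu, hum, hul⟩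
      · simp only [Function.update_self] at hul
        exact absurd hul.symm hja
  honest_depth_mono v₁ v₂ hp₁ hv₁ hp₂ hv₂ h₁ h₂ hlt := by
    have old : ∀ v, 0 < v → v < F.m →
        Function.update w a (some false) (F.label v) = some false →
        w (F.label v) = some false := fun v hpos hv h => by
      rwa [Function.update_of_ne] at h
      exact fun h' => (F.label_valid v hpos hv).2.2 (h' ▸ hwa)
    rcases Nat.lt_succ_iff_lt_or_eq.1 hv₁ with hv₁ | rfl
    · rw [Function.update_of_ne hv₁.ne] at h₁ hlt
      have h₁ := old v₁ hp₁ hv₁ h₁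
      rw [F.treeDepth_update_parent hp hv₁]
      rcases Nat.lt_succ_iff_lt_or_eq.1 hv₂ with hv₂ | rfl
      · rw [Function.update_of_ne hv₂.ne] at h₂ hlt
        rw [F.treeDepth_update_parent hp hv₂]
        exact F.honest_depth_mono v₁ v₂ hp₁ hv₁ hp₂ hv₂ h₁ (old v₂ hp₂ hv₂ h₂) hlt
      · rw [treeDepth_eq_succ (F.update_parent_lt hp) hp₂ hv₂, Function.update_self,
          F.treeDepth_update_parent hp hp]
        exact Nat.lt_succ_of_le (hmax v₁ hp₁ hv₁ h₁)
    · rcases Nat.lt_succ_iff_lt_or_eq.1 hv₂ with hv₂ | rfl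
      · rw [Function.update_of_ne hv₂.ne] at h₂ hlt
        rw [Function.update_self] at hlt
        exact absurd hlt (hlast _ (F.label_valid v₂ hp₂ hv₂).2.1 (old v₂ hp₂ hv₂ h₂)).not_gt
      · exact absurd hlt (lt_irrefl _)

/-- There is a vertex, the root or an honest one, at least as deep as all honest vertices. -/
lemma exists_deepest_honest (F : Fork i w) :
    ∃ p, p < F.m ∧ (p = 0 ∨ w (F.label p) = some false) ∧
      ∀ v, 0 < v → v < F.m → w (F.label v) = some false → F.depth v ≤ F.depth p := by
  obtain ⟨p, hp, hmax⟩ := Finset.exists_max_image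
    ((Finset.range F.m).filter fun v => v = 0 ∨ w (F.label v) = some false) F.depth
    ⟨0, by simp [F.m_pos]⟩
  simp only [Finset.mem_filter, Finset.mem_range] at hp hmax
  exact ⟨p, hp.1, hp.2, fun v _ hv h => hmax v ⟨hv, .inr h⟩⟩

lemma Balanced.exists_update {F : Fork i w} {s l a : ℕ} (hF : F.Balanced s l) (hla : l < a)
    (hai : a ≤ i) (hwa : w a = none) (hlast : ∀ j, j ≤ i → w j = some false → j < a) :
    ∃ F' : Fork i (Function.update w a (some false)), F'.Balanced s l := by
  obtain ⟨p, hp, hp', hmax⟩ := F.exists_deepest_honest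
  have hpa : F.label p < a := by
    rcases Nat.eq_zero_or_pos p with rfl | hpos
    · rw [F.label_root]; omega
    · exact hlast _ (F.label_valid p hpos hp).2.1 (hp'.resolve_left hpos.ne')
  let F' := F.addHonest a p (by omega) hai hwa hlast hp hpa hmax
  have hviable : ∀ v, v < F.m → F.Viable l v → F'.Viable l v := by
    intro v hv h j hj₁ hjl hj u hu hum hul
    rw [Function.update_of_ne (by omega)] at hj
    rcases Nat.lt_succ_iff_lt_or_eq.1 hum with hum | rfl
    · change treeDepth (Function.update F.parent F.m p) u ≤
        treeDepth (Function.update F.parent F.m p) v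
      rw [F.treeDepth_update_parent hp hum, F.treeDepth_update_parent hp hv]
      refine h j hj₁ hjl hj u hu hum ?_
      rw [← hul]
      exact (Function.update_of_ne hum.ne _ _).symm
    · change Function.update F.label F.m a F.m = j at hul
      rw [Function.update_self] at hul
      omega
  have hpar : ∀ v, v < F.m → id (F.parent v) = F'.parent (id v) := by
    intro v hv
    change F.parent v = Function.update F.parent F.m p v
    rw [Function.update_of_ne hv.ne]
  obtain ⟨v₁, v₂, h₁, h₂, hv₁, hv₂, hd⟩ := hF
  refine ⟨F', v₁, v₂, Nat.lt_succ_of_lt h₁, Nat.lt_succ_of_lt h₂, hviable v₁ h₁ hv₁,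
    hviable v₂ h₂ hv₂, ?_⟩
  rintro u ⟨k₁, hk₁⟩ ⟨k₂, hk₂⟩
  have e₁ : F.parent^[k₁] v₁ = u := (iterate_parent_map hpar h₁ k₁).trans hk₁
  have e₂ : F.parent^[k₂] v₂ = u := (iterate_parent_map hpar h₂ k₂).trans hk₂
  have hu : u < F.m := e₁ ▸ F.iterate_parent_lt_m h₁ k₁
  have hlab : F'.label u = F.label u := Function.update_of_ne hu.ne _ _
  rw [hlab]
  exact hd u ⟨k₁, e₁⟩ ⟨k₂, e₂⟩

end Fork

lemma Ol_eq_some_false_iff {l j : ℕ} {w : ℕ → Trit} :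
    Ol l w j = some false ↔ j ≤ l ∧ w j = some false := by
  unfold Ol
  split_ifs with h
  · simp only [false_iff, not_and]
    exact fun h' => absurd h.1 (by omega)
  · refine ⟨fun h' => ⟨?_, h'⟩, fun h' => h'.2⟩
    by_contra hlt
    exact h ⟨by omega, h'⟩

lemma Ol_apply_of_le {l j : ℕ} (h : j ≤ l) (w : ℕ → Trit) : Ol l w j = w j :=
  if_neg fun h' => absurd h'.1 (by omega)

lemma Ol_succ_of_ne {k : ℕ} {w : ℕ → Trit} (h : w (k + 1) ≠ some false) :
    Ol (k + 1) w = Ol k w := by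
  funext j
  rcases eq_or_ne j (k + 1) with rfl | hj
  · simp [Ol, h]
  · have : k + 1 < j ↔ k < j := by omega
    simp [Ol, this]

lemma Ol_succ_of_eq {k : ℕ} {w : ℕ → Trit} (h : w (k + 1) = some false) :
    Ol (k + 1) w = Function.update (Ol k w) (k + 1) (some false) := by
  funext j
  rcases eq_or_ne j (k + 1) with rfl | hj
  · simp [Ol, h]
  · have : k + 1 < j ↔ k < j := by omega
    simp [Ol, this, Function.update_of_ne hj]

namespace Fork

variable {i : ℕ} {w w' : ℕ → Trit}

lemma Balanced.exists_of_Ol {s l : ℕ} (hl : l ≤ i) {F : Fork i (Ol l w)}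
    (hF : F.Balanced s l) : ∃ F' : Fork i w, F'.Balanced s l := by
  have key : ∀ k, l ≤ k → k ≤ i → ∃ F' : Fork i (Ol k w), F'.Balanced s l := by
    intro k hk
    induction k, hk using Nat.le_induction with
    | base => exact fun _ => ⟨F, hF⟩
    | succ k hk ih =>
      intro hki
      obtain ⟨F', hF'⟩ := ih (by omega)
      by_cases h : w (k + 1) = some false
      · rw [Ol_succ_of_eq h]
        refine hF'.exists_update (by omega) hki (by simp [Ol, h]) fun j _ hj => ?_
        have := (Ol_eq_some_false_iff.1 hj).1
        omega
      · rw [Ol_succ_of_ne h]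
        exact ⟨F', hF'⟩
  obtain ⟨F', hF'⟩ := key i hl le_rfl
  exact ⟨_, hF'.congr hl fun j _ hj => Ol_apply_of_le hj w⟩

/-- No vertex of the tine ending at `v` is an honest vertex with label greater than `l`. -/
def HonestLabelsLE (F : Fork i w) (l v : ℕ) : Prop :=
  ∀ u, F.Ancestor u v → w (F.label u) = some false → F.label u ≤ l

lemma HonestLabelsLE.parent {F : Fork i w} {l v : ℕ} (h : F.HonestLabelsLE l v) :
    F.HonestLabelsLE l (F.parent v) := fun u hu => h u hu.of_parent

lemma honestLabelsLE_of_label_le (F : Fork i w) {l v : ℕ} (hv : v < F.m)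
    (h : F.label v ≤ l) : F.HonestLabelsLE l v :=
  fun _ hu _ => (F.label_le_of_ancestor hv hu).trans h

lemma depth_eq_succ (F : Fork i w) {v : ℕ} (hpos : 0 < v) (hv : v < F.m) :
    F.depth v = F.depth (F.parent v) + 1 :=
  treeDepth_eq_succ F.parent_lt hpos hv

/-- Cutting an `l`-viable tine just before its first honest vertex with label greater than `l`
leaves an `l`-viable tine. -/
lemma Viable.exists_honestLabelsLE {F : Fork i w} {l v : ℕ} (hv : v < F.m)
    (h : F.Viable l v) :
    ∃ u, u < F.m ∧ F.Ancestor u v ∧ F.Viable l u ∧ F.HonestLabelsLE l u := by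
  by_cases hS : F.HonestLabelsLE l v
  · exact ⟨v, hv, .refl F v, h, hS⟩
  clear h
  induction v using Nat.strong_induction_on with
  | _ v ih =>
    rcases Nat.eq_zero_or_pos v with rfl | hpos
    · exact absurd (F.honestLabelsLE_of_label_le hv (by simp [F.label_root])) hS
    have hpm := F.parent_lt_m hv
    by_cases hSp : F.HonestLabelsLE l (F.parent v)
    · refine ⟨F.parent v, hpm, (Ancestor.refl F _).of_parent, ?_, hSp⟩
      have hbad : w (F.label v) = some false ∧ l < F.label v := by
        by_contra hgood
        refine hS fun u hu hwu => ?_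
        rcases hu.eq_or_parent with rfl | hu
        · exact not_lt.1 fun hlt => hgood ⟨hwu, hlt⟩
        · exact hSp u hu hwu
      intro j hj₁ hjl hj u hu hum hul
      have hlt : F.depth u < F.depth v :=
        F.honest_depth_mono u v hu hum hpos hv (hul ▸ hj) hbad.1 (by omega)
      have := F.depth_eq_succ hpos hv
      omega
    · obtain ⟨u, hum, hu, hvia, hSu⟩ := ih _ (F.parent_lt v hpos hv) hpm hSp
      exact ⟨u, hum, hu.of_parent, hvia, hSu⟩

section Restrict

open Classical

/-- The vertex set of a restriction, extended by all natural numbers `≥ m`. -/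
def RestrictSet (F : Fork i w) (S : ℕ → Prop) (v : ℕ) : Prop := F.m ≤ v ∨ S v

/-- The vertex of `F` corresponding to a vertex of the restriction of `F` to `S`. -/
noncomputable def restrictEmb (F : Fork i w) (S : ℕ → Prop) : ℕ → ℕ :=
  Nat.nth (F.RestrictSet S)

lemma restrictSet_infinite (F : Fork i w) (S : ℕ → Prop) :
    {v | F.RestrictSet S v}.Infinite :=
  (Set.infinite_of_injective_forall_mem (f := fun k => F.m + k)
    (fun _ _ h => Nat.add_left_cancel h) fun k => Or.inl (Nat.le_add_right _ k))

lemma restrictEmb_strictMono (F : Fork i w) (S : ℕ → Prop) : StrictMono (F.restrictEmb S) :=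
  Nat.nth_strictMono (F.restrictSet_infinite S)

/-- The number of vertices of the restriction of `F` to `S`. -/
noncomputable def restrictCard (F : Fork i w) (S : ℕ → Prop) : ℕ :=
  Nat.count (F.RestrictSet S) F.m

lemma restrictEmb_lt (F : Fork i w) {S : ℕ → Prop} {v : ℕ} (hv : v < F.restrictCard S) :
    F.restrictEmb S v < F.m := Nat.nth_lt_of_lt_count hv

lemma restrictEmb_mem (F : Fork i w) {S : ℕ → Prop} {v : ℕ} (hv : v < F.restrictCard S) :
    S (F.restrictEmb S v) :=
  (Nat.nth_mem_of_infinite (F.restrictSet_infinite S) v).resolve_left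
    (F.restrictEmb_lt hv).not_ge

lemma exists_restrictEmb_eq (F : Fork i w) {S : ℕ → Prop} {v : ℕ} (hv : v < F.m) (hS : S v) :
    ∃ u < F.restrictCard S, F.restrictEmb S u = v := by
  have h := Nat.nth_count (p := F.RestrictSet S) (n := v) (.inr hS)
  refine ⟨Nat.count (F.RestrictSet S) v, ?_, h⟩
  exact Nat.count_strict_mono (.inr hS) hv

lemma restrictEmb_zero (F : Fork i w) {S : ℕ → Prop} (h₀ : S 0) : F.restrictEmb S 0 = 0 :=
  Nat.nth_zero_of_zero (.inr h₀)

lemma restrictEmb_pos (F : Fork i w) {S : ℕ → Prop} {v : ℕ} (hv : 0 < v) :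
    0 < F.restrictEmb S v :=
  (Nat.zero_le _).trans_lt (F.restrictEmb_strictMono S hv)

/-- The parent function of the restriction of `F` to `S`. -/
noncomputable def restrictParent (F : Fork i w) (S : ℕ → Prop) (v : ℕ) : ℕ :=
  Nat.count (F.RestrictSet S) (F.parent (F.restrictEmb S v))

lemma restrictEmb_restrictParent (F : Fork i w) {S : ℕ → Prop}
    (hpar : ∀ v, v < F.m → S v → S (F.parent v)) {v : ℕ} (hv : v < F.restrictCard S) :
    F.restrictEmb S (F.restrictParent S v) = F.parent (F.restrictEmb S v) :=
  Nat.nth_count (.inr (hpar _ (F.restrictEmb_lt hv) (F.restrictEmb_mem hv)))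

lemma restrictParent_lt (F : Fork i w) {S : ℕ → Prop}
    (hpar : ∀ v, v < F.m → S v → S (F.parent v)) (v : ℕ) (hpos : 0 < v)
    (hv : v < F.restrictCard S) : F.restrictParent S v < v := by
  rw [← (F.restrictEmb_strictMono S).lt_iff_lt, F.restrictEmb_restrictParent hpar hv]
  exact F.parent_lt _ (F.restrictEmb_pos hpos) (F.restrictEmb_lt hv)

lemma treeDepth_restrictParent (F : Fork i w) {S : ℕ → Prop} (h₀ : S 0)
    (hpar : ∀ v, v < F.m → S v → S (F.parent v)) {v : ℕ} (hv : v < F.restrictCard S) :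
    treeDepth (F.restrictParent S) v = F.depth (F.restrictEmb S v) :=
  (treeDepth_map F.parent_lt (F.restrictParent_lt hpar) (F.restrictEmb_zero h₀)
    (fun _ hpos _ => F.restrictEmb_pos hpos) (fun _ => F.restrictEmb_lt)
    (fun _ _ => F.restrictEmb_restrictParent hpar) hv).symm

/-- The restriction of a fork to a set of vertices closed under taking parents. -/
noncomputable def restrict (F : Fork i w) (S : ℕ → Prop) (h₀ : S 0)
    (hpar : ∀ v, v < F.m → S v → S (F.parent v))
    (hvalid : ∀ v, 0 < v → v < F.m → S v → w' (F.label v) ≠ none)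
    (hhonest : ∀ j, w' j = some false → w j = some false)
    (hmem : ∀ v, v < F.m → w' (F.label v) = some false → S v) : Fork i w' where
  m := F.restrictCard S
  m_pos := by
    obtain ⟨u, hu, -⟩ := F.exists_restrictEmb_eq F.m_pos h₀
    exact (Nat.zero_le u).trans_lt hu
  parent := F.restrictParent S
  label v := F.label (F.restrictEmb S v)
  parent_root := by
    rw [restrictParent, F.restrictEmb_zero h₀, F.parent_root, Nat.count_zero]
  parent_lt := F.restrictParent_lt hpar
  label_root := by rw [F.restrictEmb_zero h₀, F.label_root]
  label_valid v hpos hv := by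
    have H := F.label_valid _ (F.restrictEmb_pos hpos) (F.restrictEmb_lt hv)
    exact ⟨H.1, H.2.1,
      hvalid _ (F.restrictEmb_pos hpos) (F.restrictEmb_lt hv) (F.restrictEmb_mem hv)⟩
  label_lt v hpos hv := by
    rw [F.restrictEmb_restrictParent hpar hv]
    exact F.label_lt _ (F.restrictEmb_pos hpos) (F.restrictEmb_lt hv)
  honest_unique j h₁ h₂ hj := by
    obtain ⟨v, ⟨hpos, hv, hlab⟩, huniq⟩ := F.honest_unique j h₁ h₂ (hhonest j hj)
    obtain ⟨u, hu, rfl⟩ := F.exists_restrictEmb_eq hv (hmem v hv (hlab ▸ hj))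
    refine ⟨u, ⟨Nat.pos_of_ne_zero ?_, hu, hlab⟩, ?_⟩
    · rintro rfl
      exact hpos.ne' (F.restrictEmb_zero h₀)
    · rintro x ⟨hx, hxm, hxl⟩
      exact (F.restrictEmb_strictMono S).injective
        (huniq _ ⟨F.restrictEmb_pos hx, F.restrictEmb_lt hxm, hxl⟩)
  honest_depth_mono v₁ v₂ hp₁ hv₁ hp₂ hv₂ h₁ h₂ hlt := by
    rw [F.treeDepth_restrictParent h₀ hpar hv₁, F.treeDepth_restrictParent h₀ hpar hv₂]
    exact F.honest_depth_mono _ _ (F.restrictEmb_pos hp₁) (F.restrictEmb_lt hv₁)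
      (F.restrictEmb_pos hp₂) (F.restrictEmb_lt hv₂) (hhonest _ h₁) (hhonest _ h₂) hlt

end Restrict

lemma Balanced.exists_Ol {s l : ℕ} {F : Fork i w} (hF : F.Balanced s l) :
    ∃ F' : Fork i (Ol l w), F'.Balanced s i := by
  obtain ⟨x₁, x₂, hx₁, hx₂, hvx₁, hvx₂, hdx⟩ := hF
  obtain ⟨y₁, hy₁, ha₁, hvy₁, hS₁⟩ := hvx₁.exists_honestLabelsLE hx₁
  obtain ⟨y₂, hy₂, ha₂, hvy₂, hS₂⟩ := hvx₂.exists_honestLabelsLE hx₂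
  have hdy := hdx.mono ha₁ ha₂
  set S := F.HonestLabelsLE l
  have h₀ : S 0 := F.honestLabelsLE_of_label_le F.m_pos (by simp [F.label_root])
  have hpar : ∀ v, v < F.m → S v → S (F.parent v) := fun _ _ h => h.parent
  have hvalid : ∀ v, 0 < v → v < F.m → S v → Ol l w (F.label v) ≠ none := by
    intro v hpos hv hSv
    rw [Ol, if_neg]
    · exact (F.label_valid v hpos hv).2.2
    · exact fun h => absurd (hSv v (.refl F v) h.2) h.1.not_ge
  let F' : Fork i (Ol l w) := F.restrict S h₀ hpar hvalid
    (fun _ hj => (Ol_eq_some_false_iff.1 hj).2)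
    (fun v hv hj => F.honestLabelsLE_of_label_le hv (Ol_eq_some_false_iff.1 hj).1)
  obtain ⟨v₁, hv₁, rfl⟩ := F.exists_restrictEmb_eq hy₁ hS₁
  obtain ⟨v₂, hv₂, rfl⟩ := F.exists_restrictEmb_eq hy₂ hS₂
  have hviable : ∀ v, v < F.restrictCard S → F.Viable l (F.restrictEmb S v) →
      F'.Viable i v := by
    intro v hv h j hj₁ _ hj u hu hum hul
    obtain ⟨hjl, hj⟩ := Ol_eq_some_false_iff.1 hj
    change treeDepth (F.restrictParent S) u ≤ treeDepth (F.restrictParent S) v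
    rw [F.treeDepth_restrictParent h₀ hpar hum, F.treeDepth_restrictParent h₀ hpar hv]
    exact h j hj₁ hjl hj _ (F.restrictEmb_pos hu) (F.restrictEmb_lt hum) hul
  have hmap : ∀ v, v < F'.m → F.restrictEmb S (F'.parent v) = F.parent (F.restrictEmb S v) :=
    fun v hv => F.restrictEmb_restrictParent hpar hv
  refine ⟨F', v₁, v₂, hv₁, hv₂, hviable v₁ hv₁ hvy₁, hviable v₂ hv₂ hvy₂, ?_⟩
  rintro u ⟨k₁, hk₁⟩ ⟨k₂, hk₂⟩
  exact hdy (F.restrictEmb S u)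
    ⟨k₁, by rw [← iterate_parent_map hmap hv₁, hk₁]⟩
    ⟨k₂, by rw [← iterate_parent_map hmap hv₂, hk₂]⟩

lemma Balanced.mono {F : Fork i w} {s l l' : ℕ} (hF : F.Balanced s l') (h : l ≤ l') :
    F.Balanced s l := by
  obtain ⟨v₁, v₂, h₁, h₂, hv₁, hv₂, hd⟩ := hF
  exact ⟨v₁, v₂, h₁, h₂, fun j hj₁ hjl => hv₁ j hj₁ (hjl.trans h),
    fun j hj₁ hjl => hv₂ j hj₁ (hjl.trans h), hd⟩

end Fork

/-- There exists an `(s, l)`-balanced fork `F ⊢ w` if and only if there exists an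
`s`-balanced fork `F' ⊢ O_l(w)`. -/
theorem stmt_13 (i : ℕ) (w : ℕ → Trit) (s : ℕ) (hs1 : 1 ≤ s) (hsi : s ≤ i)
    (l : ℕ) (hl : l ≤ i) :
    (∃ F : Fork i w, F.Balanced s l) ↔ ∃ F' : Fork i (Ol l w), F'.Balanced s i :=
  ⟨fun ⟨_, hF⟩ => hF.exists_Ol, fun ⟨_, hF⟩ => (hF.mono hl).exists_of_Ol hl⟩
end

section
/- Let w ∈ {⊥,0,1}^ℕ be an infinite string, let l, s ∈ ℕ, and let Reach and Margin_s be defined on finite prefixes by the stated recursions. Then for every i ≥ l: Reach(O_l(w)[1:i]) = Reach(w[1:l]) + N₁(w[l+1:i]) ≤ Reach(w[1:i]) + N₀(w[l+1:i]), and Margin_s(O_l(w)[1:i]) = Margin_s(w[1:l]) + N₁(w[l+1:i]) ≤ Margin_s(w[1:i]) + N₀(w[l+1:i]). -/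
/-- `Reach(w[1:i])`, defined by the recursion: `Reach(w[1:0]) = 0`;
`Reach(w[1:i]) = Reach(w[1:i-1])` if `w[i] = ⊥`; `Reach(w[1:i-1]) + 1` if
`w[i] = 1`; and `max(Reach(w[1:i-1]) - 1, 0)` if `w[i] = 0` (here via truncated
subtraction on `ℕ`). -/
def reachRec (w : ℕ → Trit) : ℕ → ℕ
  | 0 => 0
  | i + 1 =>
    match w (i + 1) with
    | none => reachRec w i
    | some true => reachRec w i + 1
    | some false => reachRec w i - 1

/-- `Margin_s(w[1:i])`, defined by the recursion: `Margin_s(w[1:i]) = Reach(w[1:i])`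
for `i < s`, and for `i ≥ s`: `Margin_s(w[1:i]) = Margin_s(w[1:i-1])` if
`w[i] = ⊥`; `Margin_s(w[1:i-1]) + 1` if `w[i] = 1`; `Margin_s(w[1:i-1])` if
`w[i] = 0` and `Reach(w[1:i-1]) > Margin_s(w[1:i-1]) = 0`; and
`Margin_s(w[1:i-1]) - 1` if `w[i] = 0` and (`Reach(w[1:i-1]) = 0` or
`Margin_s(w[1:i-1]) ≠ 0`). -/
def marginRec (w : ℕ → Trit) (s : ℕ) : ℕ → ℤ
  | 0 => (reachRec w 0 : ℤ)
  | i + 1 =>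
    if i + 1 < s then (reachRec w (i + 1) : ℤ)
    else
      match w (i + 1) with
      | none => marginRec w s i
      | some true => marginRec w s i + 1
      | some false =>
        if 0 < reachRec w i ∧ marginRec w s i = 0 then marginRec w s i
        else marginRec w s i - 1

/-- `N_x(w[a:b])`: the number of positions `j` with `a ≤ j ≤ b` and `w[j] = x`. -/
def countSym (w : ℕ → Trit) (x : Trit) (a b : ℕ) : ℕ :=
  ((Finset.Icc a b).filter fun j => w j = x).card

theorem countSym_empty (w : ℕ → Trit) (x : Trit) (a : ℕ) : countSym w x (a + 1) a = 0 := by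
  simp [countSym]

theorem countSym_succ (w : ℕ → Trit) (x : Trit) {a b : ℕ} (h : a ≤ b + 1) :
    countSym w x a (b + 1) = countSym w x a b + if w (b + 1) = x then 1 else 0 := by
  unfold countSym
  rw [← Finset.insert_Icc_right_eq_Icc_add_one h, Finset.filter_insert]
  split_ifs <;> simp

theorem reachRec_congr {v w : ℕ → Trit} {i : ℕ} (h : ∀ j ≤ i, v j = w j) :
    reachRec v i = reachRec w i := by
  induction i with
  | zero => rfl
  | succ i ih =>
    simp only [reachRec, h (i + 1) le_rfl, ih fun j hj => h j (by omega)]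

theorem marginRec_congr {v w : ℕ → Trit} (s : ℕ) {i : ℕ} (h : ∀ j ≤ i, v j = w j) :
    marginRec v s i = marginRec w s i := by
  induction i with
  | zero => rfl
  | succ i ih =>
    have h' : ∀ j ≤ i, v j = w j := fun j hj => h j (by omega)
    simp only [marginRec, h (i + 1) le_rfl, ih h', reachRec_congr h, reachRec_congr h']

theorem marginRec_of_lt (w : ℕ → Trit) {s i : ℕ} (h : i < s) :
    marginRec w s i = reachRec w i := by
  cases i with
  | zero => rfl
  | succ i => simp only [marginRec, if_pos h]

theorem Ol_of_le (w : ℕ → Trit) {l j : ℕ} (h : j ≤ l) : Ol l w j = w j := by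
  simp [Ol, h.not_gt]

theorem reachRec_Ol (w : ℕ → Trit) {l i : ℕ} (hi : l ≤ i) :
    reachRec (Ol l w) i = reachRec w l + countSym w (some true) (l + 1) i := by
  induction i, hi using Nat.le_induction with
  | base => rw [countSym_empty, reachRec_congr fun j => Ol_of_le w, add_zero]
  | succ i hi ih =>
    rw [countSym_succ w _ (by omega), reachRec, ih]
    have hl : l < i + 1 := by omega
    rcases hw : w (i + 1) with _ | _ | _ <;> simp [Ol, hw, hl, add_assoc]

theorem reachRec_add_countSym_le (w : ℕ → Trit) {l i : ℕ} (hi : l ≤ i) :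
    reachRec w l + countSym w (some true) (l + 1) i
      ≤ reachRec w i + countSym w (some false) (l + 1) i := by
  induction i, hi using Nat.le_induction with
  | base => simp [countSym_empty]
  | succ i hi ih =>
    rw [countSym_succ w _ (by omega), countSym_succ w _ (by omega), reachRec]
    rcases hw : w (i + 1) with _ | _ | _ <;> simp <;> omega

theorem marginRec_Ol (w : ℕ → Trit) (s : ℕ) {l i : ℕ} (hi : l ≤ i) :
    marginRec (Ol l w) s i = marginRec w s l + countSym w (some true) (l + 1) i := by
  induction i, hi using Nat.le_induction with
  | base => rw [countSym_empty, marginRec_congr s fun j => Ol_of_le w]; simp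
  | succ i hi ih =>
    by_cases hs : i + 1 < s
    · rw [marginRec_of_lt _ hs, marginRec_of_lt w (show l < s by omega),
        reachRec_Ol w (by omega)]
      push_cast
      rfl
    · rw [countSym_succ w _ (by omega), marginRec, if_neg hs, ih]
      have hl : l < i + 1 := by omega
      rcases hw : w (i + 1) with _ | _ | _ <;> simp [Ol, hw, hl, add_assoc]

theorem marginRec_add_countSym_le (w : ℕ → Trit) (s : ℕ) {l i : ℕ} (hi : l ≤ i) :
    marginRec w s l + countSym w (some true) (l + 1) i
      ≤ marginRec w s i + countSym w (some false) (l + 1) i := by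
  induction i, hi using Nat.le_induction with
  | base => simp [countSym_empty]
  | succ i hi ih =>
    by_cases hs : i + 1 < s
    · rw [marginRec_of_lt _ hs, marginRec_of_lt w (show l < s by omega)]
      exact_mod_cast reachRec_add_countSym_le w (Nat.le_succ_of_le hi)
    · rw [countSym_succ w _ (by omega), countSym_succ w _ (by omega), marginRec, if_neg hs]
      rcases hw : w (i + 1) with _ | _ | _ <;> simp <;> (try split_ifs) <;> omega

/-- For every `i ≥ l`:
`Reach(O_l(w)[1:i]) = Reach(w[1:l]) + N₁(w[l+1:i]) ≤ Reach(w[1:i]) + N₀(w[l+1:i])`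
and
`Margin_s(O_l(w)[1:i]) = Margin_s(w[1:l]) + N₁(w[l+1:i])
  ≤ Margin_s(w[1:i]) + N₀(w[l+1:i])`. -/
theorem stmt_15 (w : ℕ → Trit) (l s : ℕ) (i : ℕ) (hi : l ≤ i) :
    (reachRec (Ol l w) i = reachRec w l + countSym w (some true) (l + 1) i ∧
      reachRec (Ol l w) i ≤ reachRec w i + countSym w (some false) (l + 1) i) ∧
    (marginRec (Ol l w) s i
        = marginRec w s l + (countSym w (some true) (l + 1) i : ℤ) ∧
      marginRec (Ol l w) s i
        ≤ marginRec w s i + (countSym w (some false) (l + 1) i : ℤ)) := by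
  rw [reachRec_Ol w hi, marginRec_Ol w s hi]
  exact ⟨⟨rfl, reachRec_add_countSym_le w hi⟩, rfl, marginRec_add_countSym_le w s hi⟩
end
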